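/- arXiv:1502.05920 — 2 statements merged into one kernel-verified Lean document; each statement's English description precedes it below -/
import Mathlib

section
/- Let p = 0. Let F be a Lévy measure on ℝ^d with ∫ |z|²∧log(1+|z|) F(dz) < ∞, and let y ∈ ℝ^d satisfy F({z : y^⊤z < −1}) = 0. Then the positive part of the function z ↦ log(1+y^⊤z) − y^⊤h(z) is F-integrable. Consequently, for any b ∈ ℝ^d and any symmetric positive semidefinite d×d matrix c, the quantity g^{(b,c,F)}(y) := y^⊤b + ((p−1)/2)·y^⊤cy + ∫ (log(1+y^⊤z) − y^⊤h(z)) F(dz) is well defined with values in [−∞,∞). -/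
open MeasureTheory Filter Set
open scoped ENNReal NNReal Topology

noncomputable section

/-- The positive part of an extended real number, as an element of `ℝ≥0∞`. -/
def EReal.posPart (x : EReal) : ℝ≥0∞ := if x = ⊤ then ⊤ else ENNReal.ofReal x.toReal

/-- Integral of an `EReal`-valued function, defined as the difference of the lintegrals of
the positive and negative parts, with the conventions of `EReal` arithmetic
(in particular `∞ - ∞ = -∞`). -/
def eIntegral {α : Type*} [MeasurableSpace α] (F : Measure α) (f : α → EReal) : EReal :=
  ((∫⁻ z, (f z).posPart ∂F : ℝ≥0∞) : EReal) - ((∫⁻ z, (-(f z)).posPart ∂F : ℝ≥0∞) : EReal)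

/-- The dot product `y^⊤ z` on `ℝ^d`. -/
def dotp {d : ℕ} (y z : EuclideanSpace ℝ (Fin d)) : ℝ := ∑ i, y i * z i

/-- The quadratic form `y^⊤ c y`. -/
def quadf {d : ℕ} (c : Matrix (Fin d) (Fin d) ℝ) (y : EuclideanSpace ℝ (Fin d)) : ℝ :=
  ∑ i, ∑ j, c i j * y i * y j

/-- The (Frobenius) norm `|c|` of a matrix. -/
def matNorm {d : ℕ} (c : Matrix (Fin d) (Fin d) ℝ) : ℝ :=
  Real.sqrt (∑ i, ∑ j, (c i j) ^ 2)

/-- A Lévy measure on `ℝ^d`: a (Borel) measure with `F({0}) = 0` and `∫ |z|² ∧ 1 F(dz) < ∞`. -/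
def IsLevyMeasure {d : ℕ} (F : Measure (EuclideanSpace ℝ (Fin d))) : Prop :=
  F {0} = 0 ∧ ∫⁻ z, ENNReal.ofReal (min (‖z‖ ^ 2) 1) ∂F < ⊤

/-- A truncation function: bounded, measurable, equal to the identity near the origin. -/
structure IsTruncation {d : ℕ}
    (h : EuclideanSpace ℝ (Fin d) → EuclideanSpace ℝ (Fin d)) : Prop where
  measurable : Measurable h
  bounded : ∃ M : ℝ, ∀ z, ‖h z‖ ≤ M
  eq_id_near_zero : ∃ δ : ℝ, 0 < δ ∧ ∀ z, ‖z‖ < δ → h z = z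

/-- The integrand `I_y(z)`, as an extended real number:
`log(1+y^⊤z) - y^⊤h(z)` if `p = 0`, and `p⁻¹(1+y^⊤z)^p - p⁻¹ - y^⊤h(z)` if `p ≠ 0`,
with the conventions `log 0 = -∞` and `0^p = +∞` for `p < 0` (so that the integrand
is `-∞` on `{1 + y^⊤z ≤ 0}` when `p ≤ 0`). -/
def Ifun {d : ℕ} (p : ℝ) (h : EuclideanSpace ℝ (Fin d) → EuclideanSpace ℝ (Fin d))
    (y z : EuclideanSpace ℝ (Fin d)) : EReal :=
  if 0 < 1 + dotp y z then
    (if p = 0 then ((Real.log (1 + dotp y z) - dotp y (h z) : ℝ) : EReal)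
      else ((p⁻¹ * (1 + dotp y z) ^ p - p⁻¹ - dotp y (h z) : ℝ) : EReal))
  else if p ≤ 0 then (⊥ : EReal)
  else ((p⁻¹ * (1 + dotp y z) ^ p - p⁻¹ - dotp y (h z) : ℝ) : EReal)

/-- The function `g^{(b,c,F)}(y) = y^⊤b + ((p-1)/2)·y^⊤cy + ∫ I_y(z) F(dz)`. -/
def gfun {d : ℕ} (p : ℝ) (h : EuclideanSpace ℝ (Fin d) → EuclideanSpace ℝ (Fin d))
    (b : EuclideanSpace ℝ (Fin d)) (c : Matrix (Fin d) (Fin d) ℝ)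
    (F : Measure (EuclideanSpace ℝ (Fin d))) (y : EuclideanSpace ℝ (Fin d)) : EReal :=
  ((dotp y b + (p - 1) / 2 * quadf c y : ℝ) : EReal) + eIntegral F (fun z => Ifun p h y z)

/-- Triples `θ = (b, c, F)`. -/
abbrev Triple (d : ℕ) :=
  EuclideanSpace ℝ (Fin d) × Matrix (Fin d) (Fin d) ℝ × Measure (EuclideanSpace ℝ (Fin d))

/-- `g^θ(y)` for a triple `θ = (b,c,F)`. -/
def gTheta {d : ℕ} (p : ℝ) (h : EuclideanSpace ℝ (Fin d) → EuclideanSpace ℝ (Fin d))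
    (θ : Triple d) (y : EuclideanSpace ℝ (Fin d)) : EReal :=
  gfun p h θ.1 θ.2.1 θ.2.2 y

/-- The integrand appearing in the definition of the constant `K`, depending on `p`
(and an extra parameter `ε > 0` when `p ∈ (0,1)`). -/
def Kintegrand {d : ℕ} (p ε : ℝ) (z : EuclideanSpace ℝ (Fin d)) : ℝ :=
  if p = 0 then min (‖z‖ ^ 2) (Real.log (1 + ‖z‖))
  else if 0 < p then min (‖z‖ ^ 2) (‖z‖ ^ (p * (1 + ε)))
  else min (‖z‖ ^ 2) 1

/-- The natural constraints `C⁰ = ∩_{F ∈ L_Θ} {y : F({z : y^⊤z < -1}) = 0}`. -/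
def natC {d : ℕ} (Θ : Set (Triple d)) : Set (EuclideanSpace ℝ (Fin d)) :=
  {y | ∀ θ ∈ Θ, θ.2.2 {z | dotp y z < -1} = 0}

/-- The sets `C⁰ₙ = ∩_{F ∈ L_Θ} {y : F({z : y^⊤z < -1 + 1/n}) = 0}`. -/
def natCn {d : ℕ} (Θ : Set (Triple d)) (n : ℕ) : Set (EuclideanSpace ℝ (Fin d)) :=
  {y | ∀ θ ∈ Θ, θ.2.2 {z | dotp y z < -1 + 1 / (n : ℝ)} = 0}

/-- The finite measure `|z|² ∧ 1 · F`. -/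
def sq1Measure {d : ℕ} (F : Measure (EuclideanSpace ℝ (Fin d))) :
    Measure (EuclideanSpace ℝ (Fin d)) :=
  F.withDensity (fun z => ENNReal.ofReal (min (‖z‖ ^ 2) 1))

/-- The standing assumptions of the paper: `p = 0` or `p ∈ (-∞,0) ∪ (0,1)`, `ε > 0`,
`h` is a truncation function, `Θ` is a nonempty convex set of Lévy triplets with `K < ∞`,
`C` is closed, convex and contains `0`, and `C ∩ C⁰` is compact. -/
structure Standing {d : ℕ} (p ε : ℝ)
    (h : EuclideanSpace ℝ (Fin d) → EuclideanSpace ℝ (Fin d))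
    (Θ : Set (Triple d)) (C : Set (EuclideanSpace ℝ (Fin d))) : Prop where
  p_range : p = 0 ∨ p < 0 ∨ (0 < p ∧ p < 1)
  eps_pos : 0 < ε
  trunc : IsTruncation h
  Theta_nonempty : Θ.Nonempty
  Theta_psd : ∀ θ ∈ Θ, (θ.2.1).PosSemidef
  Theta_levy : ∀ θ ∈ Θ, IsLevyMeasure θ.2.2
  Theta_convex : ∀ θ₁ ∈ Θ, ∀ θ₂ ∈ Θ, ∀ t : ℝ, 0 ≤ t → t ≤ 1 →
    (t • θ₁.1 + (1 - t) • θ₂.1, t • θ₁.2.1 + (1 - t) • θ₂.2.1,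
      ENNReal.ofReal t • θ₁.2.2 + ENNReal.ofReal (1 - t) • θ₂.2.2) ∈ Θ
  K_finite : ∃ K : ℝ, ∀ θ ∈ Θ,
    (∫⁻ z, ENNReal.ofReal (Kintegrand p ε z) ∂θ.2.2) ≠ ⊤ ∧
    ‖θ.1‖ + matNorm θ.2.1 + (∫⁻ z, ENNReal.ofReal (Kintegrand p ε z) ∂θ.2.2).toReal ≤ K
  C_closed : IsClosed C
  C_convex : Convex ℝ C
  C_zero : (0 : EuclideanSpace ℝ (Fin d)) ∈ C
  CC0_compact : IsCompact (C ∩ natC Θ)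

lemma EReal.posPart_coe (x : ℝ) : (x : EReal).posPart = ENNReal.ofReal x := by
  simp [EReal.posPart]

lemma EReal.posPart_bot : (⊥ : EReal).posPart = 0 := by
  simp [EReal.posPart]

lemma abs_dotp_le {d : ℕ} (y z : EuclideanSpace ℝ (Fin d)) : |dotp y z| ≤ ‖y‖ * ‖z‖ := by
  have hyz : dotp y z = inner ℝ z y := by
    simp [dotp, PiLp.inner_apply]
  rw [hyz, mul_comm]
  exact abs_real_inner_le_norm z y

lemma log_one_add_mul_le {a b : ℝ} (ha : 0 ≤ a) (hb : 0 ≤ b) :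
    Real.log (1 + a * b) ≤ a + Real.log (1 + b) := by
  have h_mul : Real.log (1 + a * b) ≤ Real.log ((1 + a) * (1 + b)) :=
    Real.log_le_log (by positivity) (by nlinarith)
  rw [Real.log_mul (by positivity) (by positivity)] at h_mul
  linarith [Real.log_le_sub_one_of_pos (show 0 < 1 + a by positivity)]

/-- Away from the origin, `A + log (1 + r)` is dominated by a multiple of
`min (r ^ 2) (log (1 + r))`. -/
lemma add_log_le_mul_min {A δ r : ℝ} (hA : 0 ≤ A) (hδ : 0 < δ) (hr : δ ≤ r) :
    A + Real.log (1 + r) ≤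
      (A / min (δ ^ 2) (Real.log (1 + δ)) + (1 + 1 / δ)) * min (r ^ 2) (Real.log (1 + r)) := by
  have hr0 : 0 < r := hδ.trans_le hr
  have hm : 0 < min (δ ^ 2) (Real.log (1 + δ)) :=
    lt_min (by positivity) (Real.log_pos (by linarith))
  have hmono : min (δ ^ 2) (Real.log (1 + δ)) ≤ min (r ^ 2) (Real.log (1 + r)) :=
    min_le_min (by gcongr) (Real.log_le_log (by linarith) (by linarith))
  have hconst : A ≤ A / min (δ ^ 2) (Real.log (1 + δ)) * min (r ^ 2) (Real.log (1 + r)) := by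
    calc A = A / min (δ ^ 2) (Real.log (1 + δ)) * min (δ ^ 2) (Real.log (1 + δ)) :=
          (div_mul_cancel₀ A hm.ne').symm
      _ ≤ _ := by gcongr
  have hlog_le : Real.log (1 + r) ≤ r := by
    linarith [Real.log_le_sub_one_of_pos (show 0 < 1 + r by linarith)]
  have hlog : Real.log (1 + r) ≤ (1 + 1 / δ) * min (r ^ 2) (Real.log (1 + r)) := by
    have hlog0 : 0 < Real.log (1 + r) := Real.log_pos (by linarith)
    have hinv : 0 < 1 / δ := by positivity
    rcases min_choice (r ^ 2) (Real.log (1 + r)) with hmin | hmin <;> rw [hmin]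
    · have hrr : r ≤ 1 / δ * r ^ 2 := by
        rw [one_div_mul_eq_div, le_div_iff₀ hδ]
        nlinarith
      nlinarith [sq_nonneg r]
    · nlinarith
  linarith

/-- The positive part of the integrand for `p = 0` is dominated by a multiple of
`min (‖z‖ ^ 2) (log (1 + ‖z‖))`. -/
lemma exists_posPart_Ifun_zero_le {d : ℕ}
    {h : EuclideanSpace ℝ (Fin d) → EuclideanSpace ℝ (Fin d)} (hh : IsTruncation h)
    (y : EuclideanSpace ℝ (Fin d)) :
    ∃ K : ℝ, ∀ z, (Ifun 0 h y z).posPart ≤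
      ENNReal.ofReal K * ENNReal.ofReal (min (‖z‖ ^ 2) (Real.log (1 + ‖z‖))) := by
  obtain ⟨M, hM⟩ := hh.bounded
  obtain ⟨δ, hδ, hid⟩ := hh.eq_id_near_zero
  have hM0 : 0 ≤ M := (norm_nonneg _).trans (hM 0)
  have hA : 0 ≤ ‖y‖ + ‖y‖ * M := by positivity
  have hm : 0 < min (δ ^ 2) (Real.log (1 + δ)) :=
    lt_min (by positivity) (Real.log_pos (by linarith))
  have hK : 0 ≤ (‖y‖ + ‖y‖ * M) / min (δ ^ 2) (Real.log (1 + δ)) + (1 + 1 / δ) := by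
    positivity
  refine ⟨(‖y‖ + ‖y‖ * M) / min (δ ^ 2) (Real.log (1 + δ)) + (1 + 1 / δ), fun z => ?_⟩
  by_cases hpos : 0 < 1 + dotp y z
  · have hI : Ifun 0 h y z = ((Real.log (1 + dotp y z) - dotp y (h z) : ℝ) : EReal) := by
      simp [Ifun, hpos]
    rw [hI, EReal.posPart_coe, ← ENNReal.ofReal_mul hK]
    rcases lt_or_ge ‖z‖ δ with hz | hz
    · rw [hid z hz, ENNReal.ofReal_of_nonpos]
      · exact zero_le
      · linarith [Real.log_le_sub_one_of_pos hpos]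
    · refine ENNReal.ofReal_le_ofReal (le_trans ?_ (add_log_le_mul_min hA hδ hz))
      have hlog : Real.log (1 + dotp y z) ≤ Real.log (1 + ‖y‖ * ‖z‖) :=
        Real.log_le_log hpos (by linarith [le_abs_self (dotp y z), abs_dotp_le y z])
      have hlog' := log_one_add_mul_le (norm_nonneg y) (norm_nonneg z)
      have hyh : ‖y‖ * ‖h z‖ ≤ ‖y‖ * M := by
        gcongr
        exact hM z
      linarith [neg_abs_le (dotp y (h z)), abs_dotp_le y (h z)]
  · have hI : Ifun 0 h y z = ⊥ := by simp [Ifun, hpos]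
    rw [hI, EReal.posPart_bot]
    exact zero_le

lemma eIntegral_lt_top {α : Type*} [MeasurableSpace α] {F : Measure α} {f : α → EReal}
    (hf : ∫⁻ z, (f z).posPart ∂F < ⊤) : eIntegral F f < ⊤ := by
  rw [eIntegral, sub_eq_add_neg]
  refine EReal.add_lt_top ?_ ?_
  · simpa using hf.ne
  · rw [Ne, EReal.neg_eq_top_iff]
    exact EReal.coe_ennreal_ne_bot _

/-- For `p = 0`, if `F` is a Lévy measure with
`∫ |z|² ∧ log(1+|z|) F(dz) < ∞` and `y` satisfies `F({z : y^⊤z < -1}) = 0`, then the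
positive part of `z ↦ log(1+y^⊤z) - y^⊤h(z)` is `F`-integrable, and for every drift `b`
and symmetric positive semidefinite matrix `c` the quantity `g^{(b,c,F)}(y)` is well
defined with values in `[-∞, ∞)`. -/
theorem stmt0 {d : ℕ} (hd : 1 ≤ d)
    (h : EuclideanSpace ℝ (Fin d) → EuclideanSpace ℝ (Fin d)) (hh : IsTruncation h)
    (F : Measure (EuclideanSpace ℝ (Fin d))) (hF : IsLevyMeasure F)
    (hFint : ∫⁻ z, ENNReal.ofReal (min (‖z‖ ^ 2) (Real.log (1 + ‖z‖))) ∂F < ⊤)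
    (y : EuclideanSpace ℝ (Fin d)) (hy : F {z | dotp y z < -1} = 0) :
    (∫⁻ z, (Ifun 0 h y z).posPart ∂F) < ⊤ ∧
    ∀ (b : EuclideanSpace ℝ (Fin d)) (c : Matrix (Fin d) (Fin d) ℝ),
      c.PosSemidef → gfun 0 h b c F y < (⊤ : EReal) := by
  have hpos : ∫⁻ z, (Ifun 0 h y z).posPart ∂F < ⊤ := by
    obtain ⟨K, hK⟩ := exists_posPart_Ifun_zero_le hh y
    calc ∫⁻ z, (Ifun 0 h y z).posPart ∂F
        ≤ ∫⁻ z, ENNReal.ofReal K *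
            ENNReal.ofReal (min (‖z‖ ^ 2) (Real.log (1 + ‖z‖))) ∂F := lintegral_mono hK
      _ = ENNReal.ofReal K *
            ∫⁻ z, ENNReal.ofReal (min (‖z‖ ^ 2) (Real.log (1 + ‖z‖))) ∂F :=
          lintegral_const_mul' _ _ ENNReal.ofReal_ne_top
      _ < ⊤ := ENNReal.mul_lt_top ENNReal.ofReal_lt_top hFint
  refine ⟨hpos, fun b c _ => EReal.add_lt_top (EReal.coe_ne_top _) ?_⟩
  exact (eIntegral_lt_top hpos).ne
end
end

section
/- Fix p with p=0 or p∈(−∞,0)∪(0,1), b ∈ ℝ^d, c a symmetric positive semidefinite d×d matrix, and a Lévy measure F on ℝ^d satisfying ∫ |z|²∧log(1+|z|) F(dz) < ∞ if p=0 and ∫ |z|²∧|z|^{p(1+ε)} F(dz) < ∞ for some ε>0 if p∈(0,1) (no extra condition if p<0). Then g^{(b,c,F)} is upper semicontinuous on C^0_F := {y ∈ ℝ^d : F({z : y^⊤z < −1}) = 0}: for every sequence yₙ ∈ C^0_F converging to y ∈ C^0_F, one has limsup_n g^{(b,c,F)}(yₙ) ≤ g^{(b,c,F)}(y) in [−∞,∞).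 -/
open MeasureTheory Filter Set
open scoped ENNReal NNReal Topology

noncomputable section

lemma dotp_eq_inner {d : ℕ} (y z : EuclideanSpace ℝ (Fin d)) : dotp y z = inner ℝ z y := by
  simp [dotp, PiLp.inner_apply]

lemma continuous_dotp_left {d : ℕ} (z : EuclideanSpace ℝ (Fin d)) :
    Continuous fun y => dotp y z := by
  simp only [dotp_eq_inner]
  fun_prop

lemma continuous_dotp_right {d : ℕ} (y : EuclideanSpace ℝ (Fin d)) :
    Continuous fun z => dotp y z := by
  simp only [dotp_eq_inner]
  fun_prop

lemma continuous_quadf {d : ℕ} (c : Matrix (Fin d) (Fin d) ℝ) : Continuous (quadf c) := by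
  unfold quadf
  fun_prop

/-- The normalized power or logarithmic utility `p⁻¹ (u ^ p - 1)`, resp. `log u` if `p = 0`. -/
def powerUtility (p u : ℝ) : ℝ := if p = 0 then Real.log u else p⁻¹ * u ^ p - p⁻¹

lemma measurable_powerUtility (p : ℝ) : Measurable (powerUtility p) := by
  unfold powerUtility
  split_ifs <;> fun_prop

lemma powerUtility_le_sub_one {p u : ℝ} (hp : p < 1) (hu : 0 < u) : powerUtility p u ≤ u - 1 := by
  have hs : -1 ≤ u - 1 := by linarith
  unfold powerUtility
  rcases lt_trichotomy p 0 with h0 | rfl | h0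
  · rw [if_neg h0.ne]
    have h1 : 1 + p * (u - 1) ≤ u ^ p := by
      have hexp := Real.add_one_le_exp (Real.log u * p)
      rw [← Real.rpow_def_of_pos hu] at hexp
      nlinarith [Real.log_le_sub_one_of_pos hu]
    have h2 : p⁻¹ * u ^ p ≤ p⁻¹ * (1 + p * (u - 1)) :=
      mul_le_mul_of_nonpos_left h1 (inv_nonpos.2 h0.le)
    have h3 : p⁻¹ * (1 + p * (u - 1)) = p⁻¹ + (u - 1) := by
      rw [mul_add, mul_one, inv_mul_cancel_left₀ h0.ne]
    linarith
  · simpa using Real.log_le_sub_one_of_pos hu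
  · rw [if_neg h0.ne']
    have h1 : u ^ p ≤ 1 + p * (u - 1) := by
      simpa using rpow_one_add_le_one_add_mul_self hs h0.le hp.le
    have h2 : p⁻¹ * u ^ p ≤ p⁻¹ * (1 + p * (u - 1)) :=
      mul_le_mul_of_nonneg_left h1 (inv_nonneg.2 h0.le)
    have h3 : p⁻¹ * (1 + p * (u - 1)) = p⁻¹ + (u - 1) := by
      rw [mul_add, mul_one, inv_mul_cancel_left₀ h0.ne']
    linarith

lemma log_one_add_mul_le_s4 {R t : ℝ} (hR : 0 ≤ R) (ht : 0 ≤ t) :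
    Real.log (1 + R * t) ≤ R + 1 + min (t ^ 2) (Real.log (1 + t)) := by
  have h1 : Real.log (1 + R * t) ≤ Real.log (1 + R) + Real.log (1 + t) := by
    rw [← Real.log_mul (by positivity) (by positivity)]
    exact Real.log_le_log (by positivity) (by nlinarith)
  have h2 : Real.log (1 + R) ≤ R := by
    linarith [Real.log_le_sub_one_of_pos (show 0 < 1 + R by positivity)]
  have h3 : Real.log (1 + t) ≤ t := by
    linarith [Real.log_le_sub_one_of_pos (show 0 < 1 + t by positivity)]
  have h4 : Real.log (1 + t) ≤ 1 + min (t ^ 2) (Real.log (1 + t)) := by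
    rcases min_cases (t ^ 2) (Real.log (1 + t)) with h | h <;> nlinarith [sq_nonneg (t - 1)]
  linarith

lemma rpow_le_one_add_rpow {t p q : ℝ} (ht : 0 ≤ t) (hp : 0 ≤ p) (hpq : p ≤ q) :
    t ^ p ≤ 1 + t ^ q := by
  rcases le_total t 1 with h | h
  · linarith [Real.rpow_le_one ht h hp, Real.rpow_nonneg ht q]
  · linarith [Real.rpow_le_rpow_of_exponent_le h hpq]

lemma one_add_mul_rpow_le {R t p ε : ℝ} (hR : 0 ≤ R) (ht : 0 ≤ t) (hp : 0 < p) (hp1 : p < 1)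
    (hε : 0 < ε) :
    (1 + R * t) ^ p ≤ (1 + R ^ p) * (1 + min (t ^ 2) (t ^ (p * (1 + ε)))) := by
  have h1 : (1 + R * t) ^ p ≤ 1 + R ^ p * t ^ p := by
    simpa [Real.mul_rpow hR ht] using
      Real.rpow_add_le_add_rpow zero_le_one (mul_nonneg hR ht) hp.le hp1.le
  have h2 : t ^ p ≤ 1 + min (t ^ 2) (t ^ (p * (1 + ε))) := by
    rw [← min_add_add_left, le_min_iff]
    constructor
    · simpa using rpow_le_one_add_rpow ht hp.le (show p ≤ (2 : ℕ) by push_cast; linarith)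
    · exact rpow_le_one_add_rpow ht hp.le (by nlinarith)
  have h3 : 0 ≤ min (t ^ 2) (t ^ (p * (1 + ε))) := le_min (by positivity) (by positivity)
  have h4 : R ^ p * t ^ p ≤ R ^ p * (1 + min (t ^ 2) (t ^ (p * (1 + ε)))) :=
    mul_le_mul_of_nonneg_left h2 (by positivity)
  linarith

lemma exists_powerUtility_bound {d : ℕ} {p : ℝ} (hp1 : p < 1)
    {F : Measure (EuclideanSpace ℝ (Fin d))}
    (hFint0 : p = 0 → ∫⁻ z, ENNReal.ofReal (min (‖z‖ ^ 2) (Real.log (1 + ‖z‖))) ∂F < ⊤)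
    (hFintp : 0 < p → p < 1 →
      ∃ ε : ℝ, 0 < ε ∧ ∫⁻ z, ENNReal.ofReal (min (‖z‖ ^ 2) (‖z‖ ^ (p * (1 + ε)))) ∂F < ⊤) :
    ∃ κ : EuclideanSpace ℝ (Fin d) → ℝ, (∀ z, 0 ≤ κ z) ∧
      ∫⁻ z, ENNReal.ofReal (κ z) ∂F < ⊤ ∧
      ∀ R, 0 ≤ R → ∃ C, 0 ≤ C ∧ ∀ z u, (0 < u ∨ 0 < p) → 0 ≤ u → u ≤ 1 + R * ‖z‖ →
        powerUtility p u ≤ C * (1 + κ z) := by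
  rcases lt_trichotomy p 0 with h0 | h0 | h0
  · refine ⟨fun _ => 0, fun _ => le_rfl, by simp, fun R _ => ⟨-p⁻¹, ?_, fun z u _ hu _ => ?_⟩⟩
    · simpa using h0.le
    · have : p⁻¹ * u ^ p ≤ 0 :=
        mul_nonpos_of_nonpos_of_nonneg (inv_nonpos.2 h0.le) (Real.rpow_nonneg hu p)
      rw [powerUtility, if_neg h0.ne]
      linarith
  · refine ⟨fun z => min (‖z‖ ^ 2) (Real.log (1 + ‖z‖)), fun z => ?_, hFint0 h0,
      fun R hR => ⟨R + 1, by positivity, fun z u hu _ huR => ?_⟩⟩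
    · exact le_min (by positivity) (Real.log_nonneg (by linarith [norm_nonneg z]))
    · have hm : 0 ≤ min (‖z‖ ^ 2) (Real.log (1 + ‖z‖)) :=
        le_min (by positivity) (Real.log_nonneg (by linarith [norm_nonneg z]))
      have hu' : 0 < u := hu.resolve_right h0.not_gt
      rw [powerUtility, if_pos h0]
      have := (Real.log_le_log hu' huR).trans (log_one_add_mul_le_s4 hR (norm_nonneg z))
      nlinarith
  · obtain ⟨ε, hε, hfin⟩ := hFintp h0 hp1
    refine ⟨_, fun z => le_min (by positivity) (by positivity), hfin,
      fun R hR => ⟨p⁻¹ * (1 + R ^ p), by positivity, fun z u _ hu huR => ?_⟩⟩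
    rw [powerUtility, if_neg h0.ne', mul_assoc]
    have h1 := (Real.rpow_le_rpow hu huR h0.le).trans
      (one_add_mul_rpow_le hR (norm_nonneg z) h0 hp1 hε)
    have h2 := mul_le_mul_of_nonneg_left h1 (inv_nonneg.2 h0.le)
    linarith [inv_nonneg.2 h0.le]

lemma Ifun_eq {d : ℕ} (p : ℝ) (h : EuclideanSpace ℝ (Fin d) → EuclideanSpace ℝ (Fin d))
    (y z : EuclideanSpace ℝ (Fin d)) :
    Ifun p h y z = if 0 < 1 + dotp y z ∨ 0 < p then
      ((powerUtility p (1 + dotp y z) - dotp y (h z) : ℝ) : EReal) else ⊥ := by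
  unfold Ifun powerUtility
  rcases lt_trichotomy p 0 with h0 | rfl | h0
  · simp [h0.ne, h0.le, h0.not_gt]
  · simp
  · simp [h0.ne', h0, h0.not_ge]

lemma measurable_Ifun {d : ℕ} (p : ℝ) {h : EuclideanSpace ℝ (Fin d) → EuclideanSpace ℝ (Fin d)}
    (hh : Measurable h) (y : EuclideanSpace ℝ (Fin d)) : Measurable fun z => Ifun p h y z := by
  have hd := (continuous_dotp_right y).measurable
  have hS : MeasurableSet {z | 0 < 1 + dotp y z ∨ 0 < p} :=
    (measurableSet_lt measurable_const (hd.const_add 1)).union (MeasurableSet.const _)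
  simp only [Ifun_eq]
  exact Measurable.ite hS
    (((measurable_powerUtility p).comp (hd.const_add 1)).sub (hd.comp hh)).coe_real_ereal
    measurable_const

lemma continuousAt_powerUtility {p u : ℝ} (hu : 0 < u ∨ 0 < p) (hp : u ≠ 0 ∨ p ≠ 0) :
    ContinuousAt (powerUtility p) u := by
  unfold powerUtility
  by_cases h0 : p = 0
  · simpa [h0] using Real.continuousAt_log (hp.resolve_right (not_not.2 h0))
  · simp only [h0, if_false]
    exact (continuousAt_const.mul
      (Real.continuousAt_rpow_const _ _ (hu.imp ne_of_gt le_of_lt))).sub continuousAt_const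

lemma tendsto_powerUtility_nhdsGT_zero {p : ℝ} (hp : p ≤ 0) :
    Tendsto (powerUtility p) (𝓝[>] 0) atBot := by
  unfold powerUtility
  rcases hp.lt_or_eq with h0 | rfl
  · simp only [h0.ne, if_false]
    exact tendsto_atBot_add_const_right _ _
      ((tendsto_rpow_neg_nhdsGT_zero h0).const_mul_atTop_of_neg (inv_lt_zero.2 h0))
  · simpa using Real.tendsto_log_nhdsGT_zero

lemma tendsto_Ifun {d : ℕ} (p : ℝ) (h : EuclideanSpace ℝ (Fin d) → EuclideanSpace ℝ (Fin d))
    {y z : EuclideanSpace ℝ (Fin d)} (hyz : 0 ≤ 1 + dotp y z) :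
    Tendsto (fun y' => Ifun p h y' z) (𝓝 y) (𝓝 (Ifun p h y z)) := by
  have hu : Tendsto (fun y' => 1 + dotp y' z) (𝓝 y) (𝓝 (1 + dotp y z)) :=
    ((continuous_dotp_left z).tendsto y).const_add 1
  have hw : Tendsto (fun y' => dotp y' (h z)) (𝓝 y) (𝓝 (dotp y (h z))) :=
    (continuous_dotp_left (h z)).tendsto y
  simp only [Ifun_eq]
  by_cases hpos : 0 < 1 + dotp y z ∨ 0 < p
  · have hev : ∀ᶠ y' in 𝓝 y, 0 < 1 + dotp y' z ∨ 0 < p := by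
      rcases hpos with h1 | h1
      · exact (hu.eventually_const_lt h1).mono fun _ => Or.inl
      · exact .of_forall fun _ => Or.inr h1
    rw [if_pos hpos]
    refine Tendsto.congr' (hev.mono fun y' hy' => (if_pos hy').symm) ?_
    exact (continuous_coe_real_ereal.tendsto _).comp
      (((continuousAt_powerUtility hpos (hpos.imp ne_of_gt ne_of_gt)).tendsto.comp hu).sub hw)
  · rw [if_neg hpos, EReal.tendsto_nhds_bot_iff_real]
    rw [not_or, not_lt, not_lt] at hpos
    intro x
    have hzero : 1 + dotp y z = 0 := le_antisymm hpos.1 hyz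
    have hsmall : ∀ᶠ u in 𝓝 (1 + dotp y z), 0 < u → powerUtility p u < x + (dotp y (h z) - 1) := by
      rw [hzero]
      exact eventually_nhdsWithin_iff.1
        ((tendsto_powerUtility_nhdsGT_zero hpos.2).eventually_lt_atBot _)
    filter_upwards [hu.eventually hsmall,
      hw.eventually_const_lt (sub_one_lt (dotp y (h z)))] with y' h1 h2
    split_ifs with h3
    · rw [EReal.coe_lt_coe_iff]
      linarith [h1 (h3.resolve_right hpos.2.not_gt)]
    · exact EReal.bot_lt_coe x

lemma measure_le_norm_lt_top {d : ℕ} {F : Measure (EuclideanSpace ℝ (Fin d))}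
    (hF : IsLevyMeasure F) {δ : ℝ} (hδ : 0 < δ) : F {z | δ ≤ ‖z‖} < ⊤ := by
  have hm : 0 < min (δ ^ 2) 1 := by positivity
  have hsub : {z : EuclideanSpace ℝ (Fin d) | δ ≤ ‖z‖} ⊆
      {z | ENNReal.ofReal (min (δ ^ 2) 1) ≤ ENNReal.ofReal (min (‖z‖ ^ 2) 1)} := fun z hz =>
    ENNReal.ofReal_le_ofReal (min_le_min_right _ (pow_le_pow_left₀ hδ.le hz 2))
  refine (measure_mono hsub).trans_lt ?_
  refine (meas_ge_le_lintegral_div (by fun_prop) (by simpa using hδ.ne') (by simp)).trans_lt ?_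
  exact ENNReal.div_lt_top hF.2.ne (by simpa using hδ.ne')

/-- On bounded sets of `y`, the positive parts of the integrands `I_y` are dominated by one
integrable function. -/
lemma exists_Ifun_posPart_bound {d : ℕ} {p : ℝ} (hp1 : p < 1)
    {h : EuclideanSpace ℝ (Fin d) → EuclideanSpace ℝ (Fin d)} (hh : IsTruncation h)
    {F : Measure (EuclideanSpace ℝ (Fin d))} (hF : IsLevyMeasure F)
    (hFint0 : p = 0 → ∫⁻ z, ENNReal.ofReal (min (‖z‖ ^ 2) (Real.log (1 + ‖z‖))) ∂F < ⊤)
    (hFintp : 0 < p → p < 1 →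
      ∃ ε : ℝ, 0 < ε ∧ ∫⁻ z, ENNReal.ofReal (min (‖z‖ ^ 2) (‖z‖ ^ (p * (1 + ε)))) ∂F < ⊤)
    {R : ℝ} (hR : 0 ≤ R) :
    ∃ G : EuclideanSpace ℝ (Fin d) → ℝ≥0∞, ∫⁻ z, G z ∂F ≠ ⊤ ∧
      ∀ y z, ‖y‖ ≤ R → 0 ≤ 1 + dotp y z → (Ifun p h y z).toENNReal ≤ G z := by
  obtain ⟨κ, hκ0, hκfin, hκ⟩ := exists_powerUtility_bound hp1 hFint0 hFintp
  obtain ⟨C, hC0, hC⟩ := hκ R hR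
  obtain ⟨M, hM⟩ := hh.bounded
  obtain ⟨δ₀, hδ₀, hid⟩ := hh.eq_id_near_zero
  have hM0 : 0 ≤ M := (norm_nonneg _).trans (hM 0)
  set K := C + R * M with hK
  have hK0 : 0 ≤ K := by positivity
  set δ := min δ₀ (1 / (R + 1)) with hδ
  have hδpos : 0 < δ := by positivity
  have hS : MeasurableSet {z : EuclideanSpace ℝ (Fin d) | δ ≤ ‖z‖} :=
    measurableSet_le measurable_const measurable_norm
  refine ⟨fun z => {z | δ ≤ ‖z‖}.indicator (fun _ => ENNReal.ofReal K) z +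
    ENNReal.ofReal K * ENNReal.ofReal (κ z), ?_, fun y z hy hyz => ?_⟩
  · rw [lintegral_add_left (measurable_const.indicator hS), lintegral_indicator_const hS,
      lintegral_const_mul' _ _ ENNReal.ofReal_ne_top]
    exact (ENNReal.add_lt_top.2 ⟨ENNReal.mul_lt_top ENNReal.ofReal_lt_top
      (measure_le_norm_lt_top hF hδpos), ENNReal.mul_lt_top ENNReal.ofReal_lt_top hκfin⟩).ne
  rw [Ifun_eq]
  split_ifs with hpos
  swap
  · simp
  have hdot : |dotp y z| ≤ R * ‖z‖ :=
    (abs_dotp_le y z).trans (mul_le_mul_of_nonneg_right hy (norm_nonneg z))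
  rw [EReal.real_coe_toENNReal]
  by_cases hz : δ ≤ ‖z‖
  · have hdoth : |dotp y (h z)| ≤ R * M :=
      (abs_dotp_le y (h z)).trans (mul_le_mul hy (hM z) (norm_nonneg _) hR)
    have hb := hC z (1 + dotp y z) hpos hyz (by linarith [(abs_le.1 hdot).2])
    beta_reduce
    rw [indicator_of_mem (show z ∈ {z | δ ≤ ‖z‖} from hz), ← ENNReal.ofReal_mul hK0,
      ← ENNReal.ofReal_add hK0 (mul_nonneg hK0 (hκ0 z))]
    refine ENNReal.ofReal_le_ofReal ?_
    have : 0 ≤ R * M * κ z := mul_nonneg (mul_nonneg hR hM0) (hκ0 z)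
    rw [hK]
    linarith [(abs_le.1 hdoth).1]
  · rw [not_le] at hz
    have hzid : h z = z := hid z (hz.trans_le (min_le_left _ _))
    have hlt : ‖z‖ < 1 / (R + 1) := hz.trans_le (min_le_right _ _)
    have hRz : R * ‖z‖ < 1 := by
      rw [lt_div_iff₀ (by positivity)] at hlt
      nlinarith [norm_nonneg z]
    have hu : 0 < 1 + dotp y z := by linarith [(abs_le.1 hdot).1]
    have hle := powerUtility_le_sub_one hp1 hu
    rw [ENNReal.ofReal_of_nonpos (by rw [hzid]; linarith)]
    exact zero_le

/-- Reverse Fatou lemma for the extended integral. -/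
lemma limsup_add_eIntegral_le {α : Type*} [MeasurableSpace α] {μ : Measure α}
    {f : ℕ → α → EReal} {g : α → EReal} {G : α → ℝ≥0∞} {r : ℕ → ℝ} {s : ℝ}
    (hf : ∀ n, Measurable (f n)) (hG : ∫⁻ z, G z ∂μ ≠ ⊤)
    (hbound : ∀ n, ∀ᵐ z ∂μ, (f n z).toENNReal ≤ G z)
    (hlim : ∀ᵐ z ∂μ, Tendsto (fun n => f n z) atTop (𝓝 (g z)))
    (hr : Tendsto r atTop (𝓝 s)) :
    limsup (fun n => (r n : EReal) + eIntegral μ (f n)) atTop ≤ (s : EReal) + eIntegral μ g := by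
  set A : ℕ → ℝ≥0∞ := fun n => ∫⁻ z, (f n z).toENNReal ∂μ
  set B : ℕ → ℝ≥0∞ := fun n => ∫⁻ z, (-(f n z)).toENNReal ∂μ
  have hA : Tendsto A atTop (𝓝 (∫⁻ z, (g z).toENNReal ∂μ)) :=
    tendsto_lintegral_of_dominated_convergence G
      (fun n => EReal.continuous_toENNReal.measurable.comp (hf n)) hbound hG
      (hlim.mono fun z hz => (EReal.continuous_toENNReal.tendsto _).comp hz)
  have hAfin : ∫⁻ z, (g z).toENNReal ∂μ ≠ ⊤ := by
    refine ((le_of_tendsto' hA fun n => lintegral_mono_ae (hbound n)).trans_lt hG.lt_top).ne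
  have hB : ∫⁻ z, (-(g z)).toENNReal ∂μ ≤ liminf B atTop := by
    calc ∫⁻ z, (-(g z)).toENNReal ∂μ
        = ∫⁻ z, liminf (fun n => (-(f n z)).toENNReal) atTop ∂μ := by
          refine lintegral_congr_ae (hlim.mono fun z hz => ?_)
          exact ((EReal.continuous_toENNReal.tendsto _).comp
            (((continuous_neg (G := EReal)).tendsto _).comp hz)).liminf_eq.symm
      _ ≤ liminf B atTop := lintegral_liminf_le fun n =>
          EReal.continuous_toENNReal.measurable.comp
            ((continuous_neg (G := EReal)).measurable.comp (hf n))
  have hu : Tendsto (fun n => (r n : EReal) + (A n : EReal)) atTop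
      (𝓝 ((s : EReal) + ((∫⁻ z, (g z).toENNReal ∂μ : ℝ≥0∞) : EReal))) :=
    (EReal.continuousAt_add (.inl (EReal.coe_ne_top s)) (.inl (EReal.coe_ne_bot s))).tendsto.comp
      (((continuous_coe_real_ereal.tendsto s).comp hr).prodMk_nhds
        ((continuous_coe_ennreal_ereal.tendsto _).comp hA))
  have hne_top : (s : EReal) + ((∫⁻ z, (g z).toENNReal ∂μ : ℝ≥0∞) : EReal) ≠ ⊤ :=
    EReal.add_ne_top (EReal.coe_ne_top s) (by simpa using hAfin)
  have hne_bot : (s : EReal) + ((∫⁻ z, (g z).toENNReal ∂μ : ℝ≥0∞) : EReal) ≠ ⊥ := by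
    simp [EReal.add_eq_bot_iff]
  have hv : limsup (fun n => -(B n : EReal)) atTop ≤
      -((∫⁻ z, (-(g z)).toENNReal ∂μ : ℝ≥0∞) : EReal) := by
    have hcoe := Monotone.map_liminf_of_continuousAt (F := (atTop : Filter ℕ))
      EReal.coe_ennreal_strictMono.monotone B continuous_coe_ennreal_ereal.continuousAt
    have hneg := EReal.limsup_neg (v := fun n => (B n : EReal)) (f := atTop)
    refine hneg.le.trans (EReal.neg_le_neg_iff.2 ?_)
    exact (EReal.coe_ennreal_le_coe_ennreal_iff.2 hB).trans hcoe.le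
  have hsplit : ∀ n, (r n : EReal) + eIntegral μ (f n) =
      ((r n : EReal) + (A n : EReal)) + -(B n : EReal) := fun n =>
    (add_assoc _ _ _).symm
  have hsplit' : (s : EReal) + eIntegral μ g =
      ((s : EReal) + ((∫⁻ z, (g z).toENNReal ∂μ : ℝ≥0∞) : EReal)) +
        -((∫⁻ z, (-(g z)).toENNReal ∂μ : ℝ≥0∞) : EReal) :=
    (add_assoc _ _ _).symm
  simp only [hsplit, hsplit']
  refine (EReal.limsup_add_le (.inl ?_) (.inl ?_)).trans (add_le_add hu.limsup_eq.le hv)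
  · rwa [hu.limsup_eq]
  · rwa [hu.limsup_eq]

/-- Under the same assumptions as Statement 3, `g^{(b,c,F)}` is upper
semicontinuous on `C⁰_F`: along any sequence in `C⁰_F` converging to a point of `C⁰_F`,
the limsup of the values is at most the value at the limit. -/
theorem stmt4 {d : ℕ} (hd : 1 ≤ d) (p : ℝ) (hp : p = 0 ∨ p < 0 ∨ (0 < p ∧ p < 1))
    (h : EuclideanSpace ℝ (Fin d) → EuclideanSpace ℝ (Fin d)) (hh : IsTruncation h)
    (b : EuclideanSpace ℝ (Fin d)) (c : Matrix (Fin d) (Fin d) ℝ) (hc : c.PosSemidef)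
    (F : Measure (EuclideanSpace ℝ (Fin d))) (hF : IsLevyMeasure F)
    (hFint0 : p = 0 → ∫⁻ z, ENNReal.ofReal (min (‖z‖ ^ 2) (Real.log (1 + ‖z‖))) ∂F < ⊤)
    (hFintp : 0 < p → p < 1 →
      ∃ ε : ℝ, 0 < ε ∧ ∫⁻ z, ENNReal.ofReal (min (‖z‖ ^ 2) (‖z‖ ^ (p * (1 + ε)))) ∂F < ⊤)
    (yseq : ℕ → EuclideanSpace ℝ (Fin d)) (y : EuclideanSpace ℝ (Fin d))
    (hyseq : ∀ n, F {z | dotp (yseq n) z < -1} = 0)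
    (hy : F {z | dotp y z < -1} = 0)
    (hconv : Tendsto yseq atTop (nhds y)) :
    Filter.limsup (fun n => gfun p h b c F (yseq n)) atTop ≤ gfun p h b c F y := by
  have hp1 : p < 1 := by
    rcases hp with h0 | h0 | h0
    · linarith
    · linarith
    · exact h0.2
  obtain ⟨R, hR⟩ := (Metric.isBounded_range_of_tendsto yseq hconv).exists_norm_le
  have hRn : ∀ n, ‖yseq n‖ ≤ R := fun n => hR _ (mem_range_self n)
  obtain ⟨G, hGfin, hG⟩ := exists_Ifun_posPart_bound hp1 hh hF hFint0 hFintp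
    ((norm_nonneg _).trans (hRn 0))
  have hae : ∀ y', F {z | dotp y' z < -1} = 0 → ∀ᵐ z ∂F, 0 ≤ 1 + dotp y' z := fun y' hy' => by
    filter_upwards [measure_eq_zero_iff_ae_notMem.1 hy'] with z hz
    have : -1 ≤ dotp y' z := not_lt.1 hz
    linarith
  refine limsup_add_eIntegral_le (fun n => measurable_Ifun p hh.measurable (yseq n)) hGfin
    (fun n => (hae _ (hyseq n)).mono fun z hz => hG _ z (hRn n) hz)
    ((hae y hy).mono fun z hz => (tendsto_Ifun p h hz).comp hconv) ?_
  exact (((continuous_dotp_left b).add (continuous_const.mul (continuous_quadf c))).tendsto y).comp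
    hconv
end
end
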